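/- Let λ be a real number with 1 < λ < 2, let Q be a positive integer, and let 1 = n_1 < n_2 < ⋯ < n_K be any finite strictly increasing list of positive integers starting with 1. Then there exist positive integers n_{K+1} < ⋯ < n_M (for some M ≥ K) extending the list, such that, writing N := n_M: Q divides N; n_j divides N for every 1 ≤ j ≤ M; and λ ≤ n_{j+1}/n_j ≤ 2 for every j with K ≤ j ≤ M−1. -/

import Mathlib

/-- Let `1 < λ < 2` be real, `Q` a positive integer, and
`1 = n 0 < n 1 < ⋯ < n (K-1)` a finite strictly increasing list of positive
integers (indexed here from `0`). Then the list can be extended to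
`n' 0 < ⋯ < n' (M-1)` (with `n' j = n j` for `j < K`) such that, writing
`N = n' (M-1)`: `Q ∣ N`; every `n' j` divides `N`; and
`λ ≤ n' (j+1) / n' j ≤ 2` for all `j` with `K - 1 ≤ j ≤ M - 2` (i.e. for all
ratios involving the appended terms). -/
theorem stmt17 (lam : ℝ) (hlam1 : 1 < lam) (hlam2 : lam < 2)
    (Q K : ℕ) (hQ : 0 < Q) (hK : 0 < K)
    (n : ℕ → ℕ) (hn0 : n 0 = 1) (hpos : ∀ i < K, 0 < n i)
    (hmono : ∀ i, i + 1 < K → n i < n (i + 1)) :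
    ∃ (M : ℕ) (n' : ℕ → ℕ), K ≤ M ∧
      (∀ j < K, n' j = n j) ∧
      (∀ j < M, 0 < n' j) ∧
      (∀ j, j + 1 < M → n' j < n' (j + 1)) ∧
      Q ∣ n' (M - 1) ∧
      (∀ j < M, n' j ∣ n' (M - 1)) ∧
      (∀ j, K - 1 ≤ j → j + 1 < M →
        lam * (n' j : ℝ) ≤ (n' (j + 1) : ℝ) ∧
          (n' (j + 1) : ℝ) ≤ 2 * (n' j : ℝ)) := by
  obtain ⟨L, hL, hQL, hnL⟩ : ∃ L : ℕ, 0 < L ∧ Q ∣ L ∧ ∀ j < K, n j ∣ L := by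
    refine ⟨Q * ∏ j ∈ Finset.range K, n j, ?_, dvd_mul_right _ _, ?_⟩
    · exact Nat.mul_pos hQ (Finset.prod_pos fun i hi => hpos i (Finset.mem_range.mp hi))
    · intro j hj
      exact (Finset.dvd_prod_of_mem n (Finset.mem_range.mpr hj)).mul_left Q
  obtain ⟨k, hk⟩ : ∃ k : ℕ, (L : ℝ) ≤ (2 - lam) * 2 ^ k := by
    obtain ⟨k, hk⟩ := pow_unbounded_of_one_lt ((L : ℝ) / (2 - lam)) (one_lt_two)
    refine ⟨k, ?_⟩
    rw [div_lt_iff₀ (by linarith)] at hk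
    linarith
  obtain ⟨q, hLq, hq1, hq2⟩ : ∃ q : ℕ, L ∣ q ∧ lam * 2 ^ k ≤ (q : ℝ) ∧ (q : ℝ) ≤ 2 * 2 ^ k := by
    refine ⟨L * ((2 * 2 ^ k) / L), dvd_mul_right _ _, ?_, ?_⟩
    · have h1 : 2 * 2 ^ k < L * ((2 * 2 ^ k) / L) + L := by
        have := Nat.div_add_mod (2 * 2 ^ k) L
        have := Nat.mod_lt (2 * 2 ^ k) hL
        omega
      have h2 : ((2 * 2 ^ k : ℕ) : ℝ) < ((L * ((2 * 2 ^ k) / L) + L : ℕ) : ℝ) := by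
        exact_mod_cast h1
      rw [Nat.cast_add] at h2
      have h3 : ((2 * 2 ^ k : ℕ) : ℝ) = 2 * 2 ^ k := by push_cast; ring
      rw [h3] at h2
      linarith
    · have h1 := Nat.mul_div_le (2 * 2 ^ k) L
      exact_mod_cast h1
  have hq : 0 < q := by
    have : (0 : ℝ) < q := lt_of_lt_of_le (by positivity) hq1
    exact_mod_cast this
  obtain ⟨a, ha⟩ : ∃ a, a = n (K - 1) := ⟨_, rfl⟩
  have hapos : 0 < a := ha ▸ hpos _ (by omega)
  obtain ⟨f, hf⟩ : ∃ f : ℕ → ℕ, f = fun i => if i ≤ k then a * 2 ^ i else a * q * 2 ^ (i - k - 1) :=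
    ⟨_, rfl⟩
  have hfpos : ∀ i, 0 < f i := by
    intro i
    simp only [hf]
    split_ifs <;> positivity
  have hfN : f (2 * k + 1) = a * q * 2 ^ k := by
    have h1 : ¬ (2 * k + 1 ≤ k) := by omega
    have h2 : 2 * k + 1 - k - 1 = k := by omega
    simp only [hf, if_neg h1, h2]
  have hfdvd : ∀ i ≤ 2 * k + 1, f i ∣ a * q * 2 ^ k := by
    intro i hi
    simp only [hf]
    split_ifs with h
    · exact mul_dvd_mul (dvd_mul_right _ _) (pow_dvd_pow _ h)
    · exact mul_dvd_mul_left _ (pow_dvd_pow _ (by omega))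
  have hfr : ∀ i, lam * (f i : ℝ) ≤ (f (i + 1) : ℝ) ∧ (f (i + 1) : ℝ) ≤ 2 * (f i : ℝ) := by
    intro i
    have hdbl : f (i + 1) = 2 * f i → lam * (f i : ℝ) ≤ (f (i + 1) : ℝ) ∧
        (f (i + 1) : ℝ) ≤ 2 * (f i : ℝ) := by
      intro h
      have h0 : (0 : ℝ) ≤ f i := Nat.cast_nonneg _
      rw [h]
      push_cast
      exact ⟨mul_le_mul_of_nonneg_right hlam2.le h0, le_rfl⟩
    rcases lt_trichotomy i k with h | h | h
    · apply hdbl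
      have h1 : i + 1 ≤ k := h
      simp only [hf, if_pos h1, if_pos h.le]
      ring
    · subst h
      have h1 : ¬ (i + 1 ≤ i) := by omega
      have h2 : i + 1 - i - 1 = 0 := by omega
      simp only [hf, if_neg h1, le_refl, if_true, h2]
      push_cast
      have h0 : (0 : ℝ) ≤ a := Nat.cast_nonneg _
      have e1 := mul_le_mul_of_nonneg_left hq1 h0
      have e2 := mul_le_mul_of_nonneg_left hq2 h0
      constructor <;> nlinarith
    · apply hdbl
      have h1 : ¬ (i + 1 ≤ k) := by omega
      have h2 : ¬ (i ≤ k) := by omega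
      have h3 : i + 1 - k - 1 = (i - k - 1) + 1 := by omega
      simp only [hf, if_neg h1, if_neg h2, h3]
      ring
  obtain ⟨g, hg⟩ : ∃ g : ℕ → ℕ, g = fun j => if j < K then n j else f (j - (K - 1)) := ⟨_, rfl⟩
  have hg1 : ∀ j < K, g j = n j := by
    intro j hj
    simp only [hg, if_pos hj]
  have hg2 : ∀ i, g (K - 1 + i) = f i := by
    intro i
    rcases Nat.eq_zero_or_pos i with h | h
    · subst h
      rw [hg1 _ (by omega), add_zero, ← ha]
      simp [hf]
    · have h1 : ¬ (K - 1 + i < K) := by omega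
      have h2 : K - 1 + i - (K - 1) = i := by omega
      simp only [hg, if_neg h1, h2]
  have hgN : g (K + (2 * k + 1) - 1) = a * q * 2 ^ k := by
    have h : K + (2 * k + 1) - 1 = K - 1 + (2 * k + 1) := by omega
    rw [h, hg2, hfN]
  have hLN : L ∣ a * q * 2 ^ k := (hLq.mul_left a).mul_right _
  have hratio : ∀ j, K - 1 ≤ j → lam * (g j : ℝ) ≤ (g (j + 1) : ℝ) ∧
      (g (j + 1) : ℝ) ≤ 2 * (g j : ℝ) := by
    intro j hj
    obtain ⟨i, rfl⟩ := Nat.exists_eq_add_of_le hj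
    rw [add_assoc, hg2, hg2]
    exact hfr i
  have hgpos : ∀ j, 0 < g j := by
    intro j
    simp only [hg]
    split_ifs with h
    · exact hpos j h
    · exact hfpos _
  refine ⟨K + (2 * k + 1), g, by omega, hg1, fun j _ => hgpos j, ?_, ?_, ?_, ?_⟩
  · intro j _
    by_cases h : j + 1 < K
    · rw [hg1 _ h, hg1 j (by omega)]
      exact hmono j h
    · have h1 := (hratio j (by omega)).1
      have h0 : (0 : ℝ) < g j := by exact_mod_cast hgpos j
      have : (g j : ℝ) < g (j + 1) := by nlinarith
      exact_mod_cast this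
  · rw [hgN]
    exact hQL.trans hLN
  · intro j hj
    rw [hgN]
    by_cases h : j < K
    · rw [hg1 j h]
      exact (hnL j h).trans hLN
    · have h1 : j = K - 1 + (j - (K - 1)) := by omega
      rw [h1, hg2]
      exact hfdvd _ (by omega)
  · intro j hj _
    exact hratio j hj
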